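/- There exist absolute constants C and c such that for every N ≥ 1, every nonzero measure ν on the boundary of the bi-tree T² of depth N satisfying |ν| ≤ E[ν], and every ε with 0 < ε < 1, one has E_ε[ν] ≤ C·ε·exp(c·√(log(1/ε)))·E[ν]. -/

import Mathlib

open Finset

def strings : ℕ → Finset (List Bool)
  | 0 => {([] : List Bool)}
  | N + 1 =>
      {([] : List Bool)} ∪ (strings N).image (List.cons true) ∪ (strings N).image (List.cons false)

/-- Vertices of the bi-tree `T²` of depth `N`: pairs of binary strings of length at most `N`,
ordered by `(α,β) ≤ (α',β')` iff `α' <+: α` and `β' <+: β`. -/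
def biVertices (N : ℕ) : Finset (List Bool × List Bool) := strings N ×ˢ strings N

/-- `𝕀 f (p) = ∑_{p' ≥ p} f p'`. -/
noncomputable def biI (N : ℕ) (f : List Bool × List Bool → ℝ) (p : List Bool × List Bool) : ℝ :=
  ∑ q ∈ (biVertices N).filter (fun q => q.1 <+: p.1 ∧ q.2 <+: p.2), f q

/-- `𝕀* f (p) = ∑_{p' ≤ p} f p'`. -/
noncomputable def biIstar (N : ℕ) (f : List Bool × List Bool → ℝ) (p : List Bool × List Bool) : ℝ :=
  ∑ q ∈ (biVertices N).filter (fun q => p.1 <+: q.1 ∧ p.2 <+: q.2), f q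

/-- The potential `V^μ = 𝕀 (𝕀* μ)` on the bi-tree. -/
noncomputable def biV (N : ℕ) (μ : List Bool × List Bool → ℝ) : List Bool × List Bool → ℝ :=
  biI N (biIstar N μ)

/-- The total mass `|μ|`. -/
noncomputable def biMass (N : ℕ) (μ : List Bool × List Bool → ℝ) : ℝ :=
  ∑ p ∈ biVertices N, μ p

/-- A measure on the boundary `∂T²`: a nonnegative function vanishing off pairs of strings
both of length exactly `N`. -/
def IsBiMeasureOnBoundary (N : ℕ) (μ : List Bool × List Bool → ℝ) : Prop :=
  (∀ p, 0 ≤ μ p) ∧ ∀ p, μ p ≠ 0 → p.1.length = N ∧ p.2.length = N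

/-- The energy `E[ν] = ∑_{α∈T²} (𝕀*ν(α))²`. -/
noncomputable def biEnergy (N : ℕ) (ν : List Bool × List Bool → ℝ) : ℝ :=
  ∑ p ∈ biVertices N, (biIstar N ν p) ^ 2

/-- The partial energy `E_ε[ν] = ∑_{α∈T² : V^ν(α) ≤ ε} (𝕀*ν(α))²`. -/
noncomputable def biPartialEnergy (N : ℕ) (ν : List Bool × List Bool → ℝ) (ε : ℝ) : ℝ :=
  ∑ p ∈ (biVertices N).filter (fun p => biV N ν p ≤ ε), (biIstar N ν p) ^ 2

/-- `cap(E) = inf { ∑ f² : f ≥ 0, 𝕀f ≥ 1 on E }` on the bi-tree of depth `N`. -/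
noncomputable def biCap (N : ℕ) (E : Set (List Bool × List Bool)) : ℝ :=
  sInf { t : ℝ | ∃ f : List Bool × List Bool → ℝ, (∀ p, 0 ≤ f p) ∧
    (∀ p ∈ E, 1 ≤ biI N f p) ∧ t = ∑ p ∈ biVertices N, (f p) ^ 2 }

/-- Superadditivity in each variable on the bi-tree of depth `N`. -/
def BiSuperadditive (N : ℕ) (g : List Bool × List Bool → ℝ) : Prop :=
  (∀ α β : List Bool, α.length < N → β.length ≤ N →
    g (α ++ [false], β) + g (α ++ [true], β) ≤ g (α, β)) ∧
  (∀ α β : List Bool, α.length ≤ N → β.length < N →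
    g (α, β ++ [false]) + g (α, β ++ [true]) ≤ g (α, β))

theorem mem_strings {N : ℕ} {a : List Bool} : a ∈ strings N ↔ a.length ≤ N := by
  induction N generalizing a with
  | zero => simp [strings]
  | succ n ih =>
    rcases a with _ | ⟨x, a⟩
    · simp [strings]
    · cases x <;> simp [strings, ih]

/-- Sum of `g` over the ancestors of `a` in the tree. -/
noncomputable def ancestorSum (N : ℕ) (g : List Bool → ℝ) (a : List Bool) : ℝ :=
  ∑ u ∈ (strings N).filter (fun u => u <+: a), g u

/-- Sum of `g` over the descendants of `a` in the tree. -/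
noncomputable def descendantSum (N : ℕ) (g : List Bool → ℝ) (a : List Bool) : ℝ :=
  ∑ u ∈ (strings N).filter (fun u => a <+: u), g u

section Tree

variable {N : ℕ} {g h k r X : List Bool → ℝ} {a : List Bool}

theorem ancestorSum_nil : ancestorSum N g [] = g [] := by
  have : (strings N).filter (fun u => u <+: []) = {[]} := by
    ext u
    simp only [mem_filter, mem_strings, List.prefix_nil, mem_singleton]
    constructor
    · exact fun h => h.2
    · rintro rfl
      simp
  rw [ancestorSum, this, sum_singleton]

theorem ancestorSum_append (x : Bool) (ha : a.length < N) :
    ancestorSum N g (a ++ [x]) = ancestorSum N g a + g (a ++ [x]) := by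
  have : (strings N).filter (fun u => u <+: a ++ [x]) =
      insert (a ++ [x]) ((strings N).filter (fun u => u <+: a)) := by
    ext u
    simp only [mem_filter, mem_strings, List.prefix_concat_iff, mem_insert]
    constructor
    · rintro ⟨h1, h2 | h2⟩
      · exact Or.inl h2
      · exact Or.inr ⟨h1, h2⟩
    · rintro (rfl | ⟨h1, h2⟩)
      · exact ⟨by simpa using ha, Or.inl rfl⟩
      · exact ⟨h1, Or.inr h2⟩
  rw [ancestorSum, this, sum_insert, add_comm]
  · rfl
  · simp only [mem_filter, not_and]
    intro _ h
    have := h.length_le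
    simp at this

theorem ancestorSum_nonneg (hg : ∀ u, 0 ≤ g u) : 0 ≤ ancestorSum N g a :=
  sum_nonneg fun u _ => hg u

theorem ancestorSum_mono (hgh : ∀ u, g u ≤ h u) : ancestorSum N g a ≤ ancestorSum N h a :=
  sum_le_sum fun u _ => hgh u

theorem ancestorSum_const_mul (t : ℝ) :
    ancestorSum N (fun u => t * g u) a = t * ancestorSum N g a := by
  simp [ancestorSum, mul_sum]

theorem le_ancestorSum (h0 : X [] ≤ r [])
    (hstep : ∀ a x, a.length < N → X (a ++ [x]) ≤ X a + r (a ++ [x])) (ha : a.length ≤ N) :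
    X a ≤ ancestorSum N r a := by
  induction a using List.reverseRecOn with
  | nil => simpa [ancestorSum_nil] using h0
  | append_singleton a x ih =>
    have ha' : a.length < N := by simpa using ha
    rw [ancestorSum_append x ha']
    linarith [hstep a x ha', ih ha'.le]

theorem sq_ancestorSum_le (hg : ∀ u, 0 ≤ g u) (ha : a.length ≤ N) :
    ancestorSum N g a ^ 2 ≤ 2 * ancestorSum N (fun u => g u * ancestorSum N g u) a := by
  rw [← ancestorSum_const_mul]
  refine le_ancestorSum (X := fun a => ancestorSum N g a ^ 2) ?_ ?_ ha
  · simp only [ancestorSum_nil]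
    nlinarith [hg []]
  · intro a x ha
    simp only [ancestorSum_append x ha]
    nlinarith [hg (a ++ [x])]

/-- `e^{s + v} - e^s ≤ v e^{s + v}`. -/
theorem exp_add_le (s v : ℝ) : Real.exp (s + v) ≤ Real.exp s + v * Real.exp (s + v) := by
  have h1 := Real.add_one_le_exp (-v)
  have h2 : Real.exp s = Real.exp (s + v) * Real.exp (-v) := by
    rw [← Real.exp_add]; congr 1; ring
  rw [h2]
  nlinarith [Real.exp_pos (s + v)]

theorem exp_ancestorSum_sub_one_le (t : ℝ) (ha : a.length ≤ N) :
    Real.exp (t * ancestorSum N g a) - 1 ≤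
      ancestorSum N (fun u => t * g u * Real.exp (t * ancestorSum N g u)) a := by
  refine le_ancestorSum (X := fun a => Real.exp (t * ancestorSum N g a) - 1) ?_ ?_ ha
  · simp only [ancestorSum_nil]
    have := exp_add_le 0 (t * g [])
    simp at this
    linarith
  · intro a x ha
    simp only [ancestorSum_append x ha]
    have := exp_add_le (t * ancestorSum N g a) (t * g (a ++ [x]))
    rw [← mul_add] at this
    linarith

theorem ancestorSum_mul_exp_le {t : ℝ} (ht : 0 ≤ t) (hg : ∀ u, 0 ≤ g u) (hk : ∀ u, 0 ≤ k u)
    (ha : a.length ≤ N) :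
    ancestorSum N g a * Real.exp (t * ancestorSum N k a) ≤
      ancestorSum N (fun u => g u * Real.exp (t * ancestorSum N k u) +
        t * k u * ancestorSum N g u * Real.exp (t * ancestorSum N k u)) a := by
  refine le_ancestorSum (X := fun a => ancestorSum N g a * Real.exp (t * ancestorSum N k a))
    ?_ ?_ ha
  · simp only [ancestorSum_nil]
    have := hg []
    have := hk []
    have : 0 ≤ t * k [] * g [] * Real.exp (t * k []) := by positivity
    linarith
  · intro a x ha
    simp only [ancestorSum_append x ha]
    have h1 := exp_add_le (t * ancestorSum N k a) (t * k (a ++ [x]))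
    rw [← mul_add] at h1
    have h2 : 0 ≤ ancestorSum N g a := ancestorSum_nonneg hg
    have h3 := mul_le_mul_of_nonneg_left h1 h2
    have h4 := hg (a ++ [x])
    have h5 := hk (a ++ [x])
    have h6 : 0 ≤ t * k (a ++ [x]) * g (a ++ [x]) *
      Real.exp (t * (ancestorSum N k a + k (a ++ [x]))) := by positivity
    linarith

theorem eq_or_append_isPrefix {u : List Bool} (h : a <+: u) :
    u = a ∨ a ++ [false] <+: u ∨ a ++ [true] <+: u := by
  obtain ⟨v, rfl⟩ := h
  rcases v with _ | ⟨x, v⟩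
  · simp
  · right
    cases x
    · exact Or.inl ⟨v, by simp⟩
    · exact Or.inr ⟨v, by simp⟩

theorem disjoint_filter_append (S : Finset (List Bool)) (a : List Bool) :
    Disjoint (S.filter (fun u => a ++ [false] <+: u)) (S.filter (fun u => a ++ [true] <+: u)) := by
  rw [Finset.disjoint_filter]
  intro u _ h1 h2
  have := List.prefix_of_prefix_length_le h1 h2 (by simp)
  simp at this

theorem descendantSum_append_add_le (hg : ∀ u, 0 ≤ g u) :
    descendantSum N g (a ++ [false]) + descendantSum N g (a ++ [true]) ≤ descendantSum N g a := by
  unfold descendantSum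
  rw [← sum_union (disjoint_filter_append _ _)]
  refine sum_le_sum_of_subset_of_nonneg ?_ fun u _ _ => hg u
  intro u hu
  simp only [mem_union, mem_filter] at hu ⊢
  rcases hu with ⟨h1, h2⟩ | ⟨h1, h2⟩ <;> exact ⟨h1, (List.prefix_append _ _).trans h2⟩

theorem descendantSum_le (hg : ∀ u, 0 ≤ g u) :
    descendantSum N g a ≤
      g a + (descendantSum N g (a ++ [false]) + descendantSum N g (a ++ [true])) := by
  unfold descendantSum
  rw [← sum_union (disjoint_filter_append _ _), ← sum_insert]
  · refine sum_le_sum_of_subset_of_nonneg ?_ fun u _ _ => hg u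
    intro u hu
    simp only [mem_filter, mem_insert, mem_union] at hu ⊢
    have := eq_or_append_isPrefix hu.2
    tauto
  · simp only [mem_union, mem_filter, not_or, not_and]
    constructor <;>
    · intro _ h
      have := h.length_le
      simp at this

theorem descendantSum_eq_zero (ha : N < a.length) : descendantSum N g a = 0 := by
  refine sum_eq_zero fun u hu => ?_
  simp only [mem_filter, mem_strings] at hu
  have := hu.2.length_le
  omega

/-- A superadditive function `g` is a Carleson-type weight: the sum over descendants of `g * h`
is at most `δ g` when the ancestor sums of `h` are at most `δ` on the support of `g`. -/
theorem descendantSum_mul_le {δ : ℝ} (hg : ∀ u, 0 ≤ g u) (hh : ∀ u, 0 ≤ h u)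
    (hsuper : ∀ a, a.length < N → g (a ++ [false]) + g (a ++ [true]) ≤ g a)
    (hδ : ∀ a, g a ≠ 0 → ancestorSum N h a ≤ δ) (ha : a.length ≤ N) :
    descendantSum N (fun u => g u * h u) a ≤ δ * g a := by
  have key : ∀ n, ∀ a : List Bool, a.length + n = N →
      descendantSum N (fun u => g u * h u) a ≤ (δ - ancestorSum N h a + h a) * g a := by
    intro n
    induction n with
    | zero =>
      intro a ha
      have h1 := descendantSum_le (N := N) (a := a) fun u => mul_nonneg (hg u) (hh u)
      rw [descendantSum_eq_zero (a := a ++ [false]) (by simp; omega),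
        descendantSum_eq_zero (a := a ++ [true]) (by simp; omega)] at h1
      rcases eq_or_ne (g a) 0 with h0 | h0
      · rw [h0] at h1 ⊢; linarith
      · nlinarith [hδ a h0, hg a]
    | succ n ih =>
      intro a ha
      have h1 := descendantSum_le (N := N) (a := a) fun u => mul_nonneg (hg u) (hh u)
      have h2 := ih (a ++ [false]) (by simp; omega)
      have h3 := ih (a ++ [true]) (by simp; omega)
      rw [ancestorSum_append _ (by omega)] at h2 h3
      have h4 := hsuper a (by omega)
      rcases eq_or_ne (g a) 0 with h0 | h0
      · have h5 : g (a ++ [false]) = 0 := by linarith [hg (a ++ [false]), hg (a ++ [true])]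
        have h6 : g (a ++ [true]) = 0 := by linarith [hg (a ++ [false]), hg (a ++ [true])]
        rw [h5] at h2
        rw [h6] at h3
        rw [h0] at h1 ⊢
        linarith
      · nlinarith [hδ a h0, hg a]
  refine (key (N - a.length) a (by omega)).trans ?_
  have : h a ≤ ancestorSum N h a :=
    single_le_sum (f := h) (fun u _ => hh u)
      (mem_filter.2 ⟨mem_strings.2 ha, List.prefix_refl a⟩)
  nlinarith [hg a]

end Tree

/-- The indicator of the relation `u <+: a`. -/
noncomputable def prefixInd (u a : List Bool) : ℝ := if u <+: a then 1 else 0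

theorem prefixInd_nonneg (u a : List Bool) : 0 ≤ prefixInd u a := by
  unfold prefixInd; split_ifs <;> norm_num

theorem prefixInd_le_one (u a : List Bool) : prefixInd u a ≤ 1 := by
  unfold prefixInd; split_ifs <;> norm_num

theorem ancestorSum_eq_sum (N : ℕ) (g : List Bool → ℝ) (a : List Bool) :
    ancestorSum N g a = ∑ u ∈ strings N, prefixInd u a * g u := by
  simp [ancestorSum, prefixInd, sum_filter]

theorem descendantSum_eq_sum (N : ℕ) (g : List Bool → ℝ) (a : List Bool) :
    descendantSum N g a = ∑ u ∈ strings N, prefixInd a u * g u := by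
  simp [descendantSum, prefixInd, sum_filter]

/-- Summation of `f` over ancestors in both variables. -/
noncomputable def biAncestorSum (N : ℕ) (f : List Bool → List Bool → ℝ) (a c : List Bool) : ℝ :=
  ancestorSum N (fun x => ancestorSum N (f x) c) a

section BiTree

variable {N : ℕ} {f : List Bool → List Bool → ℝ} {a c : List Bool}

theorem biAncestorSum_eq_swap :
    biAncestorSum N f a c = ancestorSum N (fun y => ancestorSum N (fun x => f x y) a) c :=
  sum_comm

theorem biAncestorSum_eq_sum : biAncestorSum N f a c =
    ∑ x ∈ strings N, ∑ y ∈ strings N, prefixInd x a * prefixInd y c * f x y := by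
  simp only [biAncestorSum, ancestorSum_eq_sum, mul_sum, mul_assoc]

theorem biAncestorSum_nonneg (hf : ∀ x y, 0 ≤ f x y) : 0 ≤ biAncestorSum N f a c :=
  ancestorSum_nonneg fun _ => ancestorSum_nonneg fun _ => hf _ _

theorem exp_biAncestorSum_sub_one_le {t : ℝ} (ht : 0 ≤ t) (hf : ∀ x y, 0 ≤ f x y)
    (ha : a.length ≤ N) (hc : c.length ≤ N) :
    Real.exp (t * biAncestorSum N f a c) - 1 ≤ biAncestorSum N (fun x y =>
      (t * f x y + t ^ 2 * (ancestorSum N (fun x => f x y) x * ancestorSum N (f x) y)) *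
        Real.exp (t * biAncestorSum N f x y)) a c := by
  refine (exp_ancestorSum_sub_one_le t ha).trans (ancestorSum_mono fun x => ?_)
  have h := ancestorSum_mul_exp_le (N := N) (g := f x)
    (k := fun y => ancestorSum N (fun x => f x y) x) ht (hf x)
    (fun y => ancestorSum_nonneg fun x => hf x y) hc
  simp only [← biAncestorSum_eq_swap] at h
  have h' := mul_le_mul_of_nonneg_left h ht
  rw [← ancestorSum_const_mul] at h'
  calc _ = t * (ancestorSum N (f x) c * Real.exp (t * biAncestorSum N f x c)) := by
        rw [biAncestorSum]; ring
    _ ≤ _ := h'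
    _ = _ := by
        congr 1
        ext y
        ring

variable {δ t : ℝ} {b d : List Bool}

/-- An ancestor pair of `(a, c)` lies above `(b, c)`, above `(a, d)`, or below `(b, d)`. -/
theorem biAncestorSum_le_add (hf : ∀ x y, 0 ≤ f x y) (hb : b <+: a) (hd : d <+: c) :
    biAncestorSum N f a c ≤ biAncestorSum N f b c + biAncestorSum N f a d +
      biAncestorSum N (fun x y => prefixInd b x * prefixInd d y * f x y) a c := by
  simp only [biAncestorSum_eq_sum, ← sum_add_distrib]
  refine sum_le_sum fun x _ => sum_le_sum fun y _ => ?_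
  have key : prefixInd x a * prefixInd y c ≤ prefixInd x b * prefixInd y c +
      prefixInd x a * prefixInd y d +
      prefixInd x a * prefixInd y c * (prefixInd b x * prefixInd d y) := by
    unfold prefixInd
    by_cases h1 : x <+: a
    · by_cases h2 : y <+: c
      · rcases List.prefix_or_prefix_of_prefix h1 hb with h3 | h3
        · simp only [h1, h2, h3, if_true]
          split_ifs <;> norm_num
        · rcases List.prefix_or_prefix_of_prefix h2 hd with h4 | h4
          · simp only [h1, h2, h3, h4, if_true]
            split_ifs <;> norm_num
          · simp only [h1, h2, h3, h4, if_true]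
            split_ifs <;> norm_num
      · simp only [h2, if_false]
        split_ifs <;> norm_num
    · simp only [h1, if_false]
      split_ifs <;> norm_num
  nlinarith [mul_le_mul_of_nonneg_right key (hf x y)]

theorem exp_biAncestorSum_le (ht : 0 ≤ t) (hf : ∀ x y, 0 ≤ f x y)
    (hδ : ∀ x y, f x y ≠ 0 → biAncestorSum N f x y ≤ δ)
    (ha : a.length ≤ N) (hc : c.length ≤ N) (hb : b <+: a) (hd : d <+: c)
    (hbc : f b c ≠ 0) (had : f a d ≠ 0) :
    Real.exp (t * biAncestorSum N f a c) ≤ Real.exp (2 * (t * δ)) *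
      (1 + ∑ x ∈ strings N, ∑ y ∈ strings N,
        prefixInd x a * prefixInd y c * (prefixInd b x * prefixInd d y *
        (t * Real.exp (t * δ) * f x y + t ^ 2 * (ancestorSum N (fun x => f x y) x *
          ancestorSum N (f x) y * Real.exp (t * biAncestorSum N f x y))))) := by
  set f' : List Bool → List Bool → ℝ := fun x y => prefixInd b x * prefixInd d y * f x y
  have hp := prefixInd_nonneg
  have hp1 := prefixInd_le_one
  have hf'0 : ∀ x y, 0 ≤ f' x y := fun x y =>
    mul_nonneg (mul_nonneg (hp _ _) (hp _ _)) (hf x y)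
  have hf'f : ∀ x y, f' x y ≤ f x y := fun x y =>
    mul_le_of_le_one_left (hf x y) (mul_le_one₀ (hp1 _ _) (hp _ _) (hp1 _ _))
  have hA : ∀ x y, ancestorSum N (fun x => f' x y) x ≤
      prefixInd b x * prefixInd d y * ancestorSum N (fun x => f x y) x := by
    intro x y
    simp only [ancestorSum_eq_sum, mul_sum]
    refine sum_le_sum fun u _ => ?_
    have : prefixInd u x * prefixInd b u ≤ prefixInd b x * prefixInd u x := by
      unfold prefixInd
      by_cases h1 : b <+: u
      · by_cases h2 : u <+: x
        · simp [h1, h2, h1.trans h2]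
        · simp [h2]
      · simp only [h1, if_false, mul_zero]
        split_ifs <;> norm_num
    have := mul_le_mul_of_nonneg_right this (mul_nonneg (hp d y) (hf u y))
    simp only [f']
    linarith
  have hB : ∀ x y, ancestorSum N (f' x) y ≤
      prefixInd b x * prefixInd d y * ancestorSum N (f x) y := by
    intro x y
    simp only [ancestorSum_eq_sum, mul_sum]
    refine sum_le_sum fun u _ => ?_
    have : prefixInd u y * prefixInd d u ≤ prefixInd d y * prefixInd u y := by
      unfold prefixInd
      by_cases h1 : d <+: u
      · by_cases h2 : u <+: y
        · simp [h1, h2, h1.trans h2]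
        · simp [h2]
      · simp only [h1, if_false, mul_zero]
        split_ifs <;> norm_num
    have := mul_le_mul_of_nonneg_right this (mul_nonneg (hp b x) (hf x u))
    simp only [f']
    linarith
  have hsplit := biAncestorSum_le_add (N := N) hf hb hd
  have h1 := hδ _ _ hbc
  have h2 := hδ _ _ had
  have hexp : Real.exp (t * biAncestorSum N f a c) ≤
      Real.exp (2 * (t * δ)) * Real.exp (t * biAncestorSum N f' a c) := by
    rw [← Real.exp_add]
    apply Real.exp_le_exp.2
    have := mul_le_mul_of_nonneg_left (a := t)
      (show biAncestorSum N f a c ≤ 2 * δ + biAncestorSum N f' a c by linarith) ht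
    linarith
  refine hexp.trans (mul_le_mul_of_nonneg_left ?_ (Real.exp_pos _).le)
  have h3 := (exp_biAncestorSum_sub_one_le (N := N) ht hf'0 ha hc).trans_eq biAncestorSum_eq_sum
  refine (sub_le_iff_le_add'.1 h3).trans (add_le_add_right ?_ 1)
  refine sum_le_sum fun x _ => sum_le_sum fun y _ =>
    mul_le_mul_of_nonneg_left ?_ (mul_nonneg (hp _ _) (hp _ _))
  have hmono : Real.exp (t * biAncestorSum N f' x y) ≤ Real.exp (t * biAncestorSum N f x y) :=
    Real.exp_le_exp.2 (mul_le_mul_of_nonneg_left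
      (ancestorSum_mono fun u => ancestorSum_mono fun v => hf'f u v) ht)
  have hA0 : 0 ≤ ancestorSum N (fun x => f x y) x := ancestorSum_nonneg fun x => hf x y
  have hB0 : 0 ≤ ancestorSum N (f x) y := ancestorSum_nonneg (hf x)
  have hB0' : 0 ≤ ancestorSum N (f' x) y := ancestorSum_nonneg (hf'0 x)
  have hw0 : 0 ≤ prefixInd b x * prefixInd d y := mul_nonneg (hp _ _) (hp _ _)
  have hw1 : prefixInd b x * prefixInd d y ≤ 1 := mul_le_one₀ (hp1 _ _) (hp _ _) (hp1 _ _)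
  have hAB : ancestorSum N (fun x => f' x y) x * ancestorSum N (f' x) y ≤
      prefixInd b x * prefixInd d y *
        (ancestorSum N (fun x => f x y) x * ancestorSum N (f x) y) := by
    calc _ ≤ (prefixInd b x * prefixInd d y * ancestorSum N (fun x => f x y) x) *
          (prefixInd b x * prefixInd d y * ancestorSum N (f x) y) :=
          mul_le_mul (hA x y) (hB x y) hB0' (mul_nonneg hw0 hA0)
      _ = (prefixInd b x * prefixInd d y) * (prefixInd b x * prefixInd d y *
          (ancestorSum N (fun x => f x y) x * ancestorSum N (f x) y)) := by ring
      _ ≤ _ := mul_le_of_le_one_left (mul_nonneg hw0 (mul_nonneg hA0 hB0)) hw1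
  have hfe : f x y * Real.exp (t * biAncestorSum N f x y) ≤ f x y * Real.exp (t * δ) := by
    rcases eq_or_ne (f x y) 0 with h | h
    · simp [h]
    · exact mul_le_mul_of_nonneg_left
        (Real.exp_le_exp.2 (mul_le_mul_of_nonneg_left (hδ x y h) ht)) (hf x y)
  calc _ ≤ (t * (prefixInd b x * prefixInd d y * f x y) + t ^ 2 * (prefixInd b x * prefixInd d y *
        (ancestorSum N (fun x => f x y) x * ancestorSum N (f x) y))) *
        Real.exp (t * biAncestorSum N f x y) := by
        refine mul_le_mul (add_le_add le_rfl (mul_le_mul_of_nonneg_left hAB (sq_nonneg t))) hmono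
          (Real.exp_pos _).le ?_
        have := mul_nonneg hw0 (hf x y)
        have := mul_nonneg hA0 hB0
        positivity
    _ = prefixInd b x * prefixInd d y * (t * (f x y * Real.exp (t * biAncestorSum N f x y)) +
        t ^ 2 * (ancestorSum N (fun x => f x y) x * ancestorSum N (f x) y *
          Real.exp (t * biAncestorSum N f x y))) := by ring
    _ ≤ prefixInd b x * prefixInd d y * (t * (f x y * Real.exp (t * δ)) +
        t ^ 2 * (ancestorSum N (fun x => f x y) x * ancestorSum N (f x) y *
          Real.exp (t * biAncestorSum N f x y))) := by
        gcongr
    _ = _ := by ring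

end BiTree

theorem sum_comm_pair {ι : Type*} (S : Finset ι) (T : ι → ι → ι → ι → ℝ) :
    ∑ a ∈ S, ∑ c ∈ S, ∑ b ∈ S, ∑ d ∈ S, T a c b d =
      ∑ b ∈ S, ∑ d ∈ S, ∑ a ∈ S, ∑ c ∈ S, T a c b d := by
  have h1 : ∀ U : ι → ι → ℝ, ∑ a ∈ S, ∑ c ∈ S, U a c = ∑ p ∈ S ×ˢ S, U p.1 p.2 :=
    fun U => (sum_product' S S U).symm
  simp only [h1]
  exact sum_comm

section Energy

variable {N : ℕ} {f : List Bool → List Bool → ℝ} {δ t : ℝ}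

/-- The estimate `∑ (I₁f)² (I₂f)² exp(t 𝕀f) ≲ δ² ∑ f²` for superadditive `f` supported where
`𝕀f ≤ δ`, before absorbing the last term. -/
theorem sum_sq_mul_exp_le_add (ht : 0 ≤ t) (hδ0 : 0 ≤ δ) (hf : ∀ x y, 0 ≤ f x y)
    (hs1 : ∀ a c, a.length < N → f (a ++ [false]) c + f (a ++ [true]) c ≤ f a c)
    (hs2 : ∀ a c, c.length < N → f a (c ++ [false]) + f a (c ++ [true]) ≤ f a c)
    (hδ : ∀ x y, f x y ≠ 0 → biAncestorSum N f x y ≤ δ) :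
    ∑ a ∈ strings N, ∑ c ∈ strings N,
      (ancestorSum N (fun x => f x c) a * ancestorSum N (f a) c) ^ 2 *
        Real.exp (t * biAncestorSum N f a c) ≤
    4 * Real.exp (2 * (t * δ)) * (δ ^ 2 * ∑ a ∈ strings N, ∑ c ∈ strings N, f a c ^ 2 +
      δ ^ 2 * ∑ a ∈ strings N, ∑ c ∈ strings N,
        (ancestorSum N (fun x => f x c) a * ancestorSum N (f a) c) *
        (t * Real.exp (t * δ) * f a c + t ^ 2 * (ancestorSum N (fun x => f x c) a *
          ancestorSum N (f a) c * Real.exp (t * biAncestorSum N f a c)))) := by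
  set S := strings N
  set A : List Bool → List Bool → ℝ := fun a c => ancestorSum N (fun x => f x c) a with hA
  set B : List Bool → List Bool → ℝ := fun a c => ancestorSum N (f a) c with hB
  set H : List Bool → List Bool → ℝ := fun a c =>
    t * Real.exp (t * δ) * f a c + t ^ 2 * (A a c * B a c *
      Real.exp (t * biAncestorSum N f a c)) with hH
  have hp := prefixInd_nonneg
  have hA0 : ∀ a c, 0 ≤ A a c := fun a c => ancestorSum_nonneg fun x => hf x c
  have hB0 : ∀ a c, 0 ≤ B a c := fun a c => ancestorSum_nonneg (hf a)
  have hH0 : ∀ a c, 0 ≤ H a c := fun a c => by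
    have := hA0 a c
    have := hB0 a c
    have := hf a c
    simp only [hH]
    positivity
  have hg1 : ∀ b c, 0 ≤ f b c * A b c := fun b c => mul_nonneg (hf b c) (hA0 b c)
  have hg2 : ∀ a d, 0 ≤ f a d * B a d := fun a d => mul_nonneg (hf a d) (hB0 a d)
  have hD1 : ∀ b, ∀ d ∈ S, ∑ c ∈ S, prefixInd d c * (f b c * A b c) ≤ δ * f b d := by
    intro b d hd
    rw [← descendantSum_eq_sum]
    exact descendantSum_mul_le (hf b) (hA0 b) (fun c hc => hs2 b c hc)
      (fun c hc => (biAncestorSum_eq_swap (N := N) (f := f)).symm.trans_le (hδ b c hc))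
      (mem_strings.1 hd)
  have hD2 : ∀ d, ∀ b ∈ S, ∑ a ∈ S, prefixInd b a * (f a d * B a d) ≤ δ * f b d := by
    intro d b hb
    rw [← descendantSum_eq_sum N (fun a => f a d * B a d)]
    exact descendantSum_mul_le (g := fun a => f a d) (h := fun a => B a d) (fun a => hf a d)
      (fun a => hB0 a d) (fun a ha => hs1 a d ha) (fun a ha => hδ a d ha) (mem_strings.1 hb)
  have hsq : ∀ a ∈ S, ∀ c ∈ S, (A a c * B a c) ^ 2 ≤ 4 * ∑ b ∈ S, ∑ d ∈ S,
      prefixInd b a * prefixInd d c * ((f b c * A b c) * (f a d * B a d)) := by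
    intro a ha c hc
    have h1 : A a c ^ 2 ≤ 2 * ∑ b ∈ S, prefixInd b a * (f b c * A b c) := by
      rw [← ancestorSum_eq_sum N (fun b => f b c * A b c)]
      exact sq_ancestorSum_le (fun x => hf x c) (mem_strings.1 ha)
    have h2 : B a c ^ 2 ≤ 2 * ∑ d ∈ S, prefixInd d c * (f a d * B a d) := by
      rw [← ancestorSum_eq_sum N (fun d => f a d * B a d)]
      exact sq_ancestorSum_le (hf a) (mem_strings.1 hc)
    calc (A a c * B a c) ^ 2 = A a c ^ 2 * B a c ^ 2 := by ring
      _ ≤ _ := mul_le_mul h1 h2 (sq_nonneg _) (le_trans (sq_nonneg _) h1)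
      _ = 4 * ((∑ b ∈ S, prefixInd b a * (f b c * A b c)) *
            ∑ d ∈ S, prefixInd d c * (f a d * B a d)) := by ring
      _ = _ := by
        rw [sum_mul_sum]
        congr 1
        refine sum_congr rfl fun b _ => sum_congr rfl fun d _ => ?_
        ring
  have hterm : ∀ a ∈ S, ∀ c ∈ S, (A a c * B a c) ^ 2 * Real.exp (t * biAncestorSum N f a c) ≤
      4 * Real.exp (2 * (t * δ)) * (∑ b ∈ S, ∑ d ∈ S,
        prefixInd b a * prefixInd d c * ((f b c * A b c) * (f a d * B a d)) +
        ∑ b ∈ S, ∑ d ∈ S, ∑ x ∈ S, ∑ y ∈ S, H x y * ((prefixInd x a * prefixInd d y *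
          (f a d * B a d)) * (prefixInd y c * prefixInd b x * (f b c * A b c)))) := by
    intro a ha c hc
    refine (mul_le_mul_of_nonneg_right (hsq a ha c hc) (Real.exp_pos _).le).trans ?_
    rw [mul_assoc, mul_assoc]
    refine mul_le_mul_of_nonneg_left ?_ (by norm_num)
    simp only [← sum_add_distrib, sum_mul, mul_sum (a := Real.exp (2 * (t * δ)))]
    refine sum_le_sum fun b _ => sum_le_sum fun d _ => ?_
    have hR0 : 0 ≤ ∑ x ∈ S, ∑ y ∈ S, H x y * ((prefixInd x a * prefixInd d y *
          (f a d * B a d)) * (prefixInd y c * prefixInd b x * (f b c * A b c))) :=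
      sum_nonneg fun x _ => sum_nonneg fun y _ => mul_nonneg (hH0 x y)
        (mul_nonneg (mul_nonneg (mul_nonneg (hp _ _) (hp _ _)) (hg2 a d))
          (mul_nonneg (mul_nonneg (hp _ _) (hp _ _)) (hg1 b c)))
    by_cases hz : b <+: a ∧ d <+: c ∧ f b c ≠ 0 ∧ f a d ≠ 0
    · obtain ⟨hb, hd, hbc, had⟩ := hz
      have h := exp_biAncestorSum_le (N := N) ht hf hδ (mem_strings.1 ha) (mem_strings.1 hc)
        hb hd hbc had
      have hk1 : prefixInd b a = 1 := by simp [prefixInd, hb]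
      have hk2 : prefixInd d c = 1 := by simp [prefixInd, hd]
      rw [hk1, hk2, one_mul, one_mul]
      refine (mul_le_mul_of_nonneg_left h (mul_nonneg (hg1 b c) (hg2 a d))).trans_eq ?_
      rw [mul_left_comm, mul_add, mul_one, mul_sum]
      congr 2
      refine sum_congr rfl fun x _ => ?_
      rw [mul_sum]
      refine sum_congr rfl fun y _ => ?_
      simp only [hH, hA, hB]
      ring
    · have h0 : prefixInd b a * prefixInd d c * ((f b c * A b c) * (f a d * B a d)) = 0 := by
        by_contra hne
        apply hz
        simp only [prefixInd] at hne
        refine ⟨?_, ?_, ?_, ?_⟩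
        · by_contra h; simp [h] at hne
        · by_contra h; simp [h] at hne
        · intro h; simp [h] at hne
        · intro h; simp [h] at hne
      rw [h0, zero_mul, zero_add]
      exact mul_nonneg (Real.exp_pos _).le hR0
  have hpart1 : ∑ a ∈ S, ∑ c ∈ S, ∑ b ∈ S, ∑ d ∈ S,
      prefixInd b a * prefixInd d c * ((f b c * A b c) * (f a d * B a d)) ≤
      δ ^ 2 * ∑ a ∈ S, ∑ c ∈ S, f a c ^ 2 := by
    rw [sum_comm_pair]
    simp only [mul_sum]
    refine sum_le_sum fun b hb => sum_le_sum fun d hd => ?_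
    calc _ = (∑ a ∈ S, prefixInd b a * (f a d * B a d)) *
          ∑ c ∈ S, prefixInd d c * (f b c * A b c) := by
          rw [sum_mul_sum]
          refine sum_congr rfl fun a _ => sum_congr rfl fun c _ => ?_
          ring
      _ ≤ (δ * f b d) * (δ * f b d) := mul_le_mul (hD2 d b hb) (hD1 b d hd)
          (sum_nonneg fun c _ => mul_nonneg (hp _ _) (hg1 b c)) (mul_nonneg hδ0 (hf b d))
      _ = _ := by ring
  have hpart2 : ∑ a ∈ S, ∑ c ∈ S, ∑ b ∈ S, ∑ d ∈ S, ∑ x ∈ S, ∑ y ∈ S,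
      H x y * ((prefixInd x a * prefixInd d y * (f a d * B a d)) *
        (prefixInd y c * prefixInd b x * (f b c * A b c))) ≤
      δ ^ 2 * ∑ x ∈ S, ∑ y ∈ S, (A x y * B x y) * H x y := by
    have hre : ∀ a ∈ S, ∀ c ∈ S, _ := fun a _ c _ => sum_comm_pair S fun b d x y =>
      H x y * ((prefixInd x a * prefixInd d y * (f a d * B a d)) *
        (prefixInd y c * prefixInd b x * (f b c * A b c)))
    rw [sum_congr rfl fun a ha => sum_congr rfl fun c hc => hre a ha c hc, sum_comm_pair]
    simp only [mul_sum (a := δ ^ 2)]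
    refine sum_le_sum fun x hx => sum_le_sum fun y hy => ?_
    have e1 : ∑ a ∈ S, ∑ d ∈ S, prefixInd x a * prefixInd d y * (f a d * B a d) ≤
        δ * B x y := by
      rw [sum_comm]
      simp only [hB, ancestorSum_eq_sum, mul_sum (a := δ)]
      refine sum_le_sum fun d _ => ?_
      have := mul_le_mul_of_nonneg_left (hD2 d x hx) (hp d y)
      rw [mul_sum] at this
      simp only [hB, ancestorSum_eq_sum] at this
      refine le_trans (le_of_eq (sum_congr rfl fun a _ => ?_)) (this.trans_eq ?_) <;> ring
    have e2 : ∑ c ∈ S, ∑ b ∈ S, prefixInd y c * prefixInd b x * (f b c * A b c) ≤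
        δ * A x y := by
      rw [sum_comm]
      simp only [hA, ancestorSum_eq_sum, mul_sum (a := δ)]
      refine sum_le_sum fun b _ => ?_
      have := mul_le_mul_of_nonneg_left (hD1 b y hy) (hp b x)
      rw [mul_sum] at this
      simp only [hA, ancestorSum_eq_sum] at this
      refine le_trans (le_of_eq (sum_congr rfl fun a _ => ?_)) (this.trans_eq ?_) <;> ring
    calc _ = H x y * ((∑ a ∈ S, ∑ d ∈ S, prefixInd x a * prefixInd d y * (f a d * B a d)) *
          ∑ c ∈ S, ∑ b ∈ S, prefixInd y c * prefixInd b x * (f b c * A b c)) := by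
          rw [sum_mul_sum, mul_sum]
          refine sum_congr rfl fun a _ => ?_
          rw [mul_sum]
          refine sum_congr rfl fun c _ => ?_
          rw [sum_mul_sum, mul_sum, sum_comm]
          refine sum_congr rfl fun d _ => ?_
          rw [mul_sum]
      _ ≤ H x y * ((δ * B x y) * (δ * A x y)) := by
          refine mul_le_mul_of_nonneg_left (mul_le_mul e1 e2 ?_ (mul_nonneg hδ0 (hB0 x y)))
            (hH0 x y)
          exact sum_nonneg fun c _ => sum_nonneg fun b _ =>
            mul_nonneg (mul_nonneg (hp _ _) (hp _ _)) (hg1 b c)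
      _ = _ := by ring
  calc _ ≤ ∑ a ∈ S, ∑ c ∈ S, 4 * Real.exp (2 * (t * δ)) * (∑ b ∈ S, ∑ d ∈ S,
        prefixInd b a * prefixInd d c * ((f b c * A b c) * (f a d * B a d)) +
        ∑ b ∈ S, ∑ d ∈ S, ∑ x ∈ S, ∑ y ∈ S, H x y * ((prefixInd x a * prefixInd d y *
          (f a d * B a d)) * (prefixInd y c * prefixInd b x * (f b c * A b c)))) :=
        sum_le_sum fun a ha => sum_le_sum fun c hc => hterm a ha c hc
    _ = 4 * Real.exp (2 * (t * δ)) * (∑ a ∈ S, ∑ c ∈ S, ∑ b ∈ S, ∑ d ∈ S,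
        prefixInd b a * prefixInd d c * ((f b c * A b c) * (f a d * B a d)) +
        ∑ a ∈ S, ∑ c ∈ S, ∑ b ∈ S, ∑ d ∈ S, ∑ x ∈ S, ∑ y ∈ S,
        H x y * ((prefixInd x a * prefixInd d y *
          (f a d * B a d)) * (prefixInd y c * prefixInd b x * (f b c * A b c)))) := by
        simp only [← mul_sum (a := 4 * Real.exp (2 * (t * δ))), sum_add_distrib]
    _ ≤ _ := mul_le_mul_of_nonneg_left (add_le_add hpart1 hpart2) (by positivity)

theorem exp_one_eighth_le : Real.exp (1 / 8) ≤ 23 / 20 := by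
  have h1 : Real.exp (1 / 8) ^ 8 = Real.exp 1 := by
    rw [← Real.exp_nat_mul]; norm_num
  by_contra! h
  have h2 := pow_lt_pow_left₀ h (by norm_num) (n := 8) (by norm_num)
  have := Real.exp_one_lt_d9
  rw [h1] at h2
  norm_num at h2
  linarith

theorem sum_sq_mul_exp_le (hδ0 : 0 < δ) (hf : ∀ x y, 0 ≤ f x y)
    (hs1 : ∀ a c, a.length < N → f (a ++ [false]) c + f (a ++ [true]) c ≤ f a c)
    (hs2 : ∀ a c, c.length < N → f a (c ++ [false]) + f a (c ++ [true]) ≤ f a c)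
    (hδ : ∀ x y, f x y ≠ 0 → biAncestorSum N f x y ≤ δ) (htδ : t * δ = 1 / 8) :
    ∑ a ∈ strings N, ∑ c ∈ strings N,
      (ancestorSum N (fun x => f x c) a * ancestorSum N (f a) c) ^ 2 *
        Real.exp (t * biAncestorSum N f a c) ≤
    13 * δ ^ 2 * ∑ a ∈ strings N, ∑ c ∈ strings N, f a c ^ 2 := by
  have ht : 0 ≤ t := by
    by_contra! h
    nlinarith
  have h := sum_sq_mul_exp_le_add ht hδ0.le hf hs1 hs2 hδ
  set Q := ∑ a ∈ strings N, ∑ c ∈ strings N,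
      (ancestorSum N (fun x => f x c) a * ancestorSum N (f a) c) ^ 2 *
        Real.exp (t * biAncestorSum N f a c) with hQ
  set E := ∑ a ∈ strings N, ∑ c ∈ strings N, f a c ^ 2 with hE
  have hE0 : 0 ≤ E := sum_nonneg fun a _ => sum_nonneg fun c _ => sq_nonneg _
  have hQ0 : 0 ≤ Q := sum_nonneg fun a _ => sum_nonneg fun c _ =>
    mul_nonneg (sq_nonneg _) (Real.exp_pos _).le
  have he := exp_one_eighth_le
  have he2 : Real.exp (2 * (1 / 8)) ≤ 1.3225 := by
    have : Real.exp (2 * (1 / 8)) = Real.exp (1 / 8) ^ 2 := by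
      rw [← Real.exp_nat_mul]; norm_num
    rw [this]
    nlinarith [Real.exp_pos (1 / 8)]
  have hcross : δ ^ 2 * ∑ a ∈ strings N, ∑ c ∈ strings N,
        (ancestorSum N (fun x => f x c) a * ancestorSum N (f a) c) *
        (t * Real.exp (t * δ) * f a c + t ^ 2 * (ancestorSum N (fun x => f x c) a *
          ancestorSum N (f a) c * Real.exp (t * biAncestorSum N f a c))) ≤
      δ ^ 2 * E + 1 / 32 * Q := by
    simp only [hQ, hE, mul_sum, ← sum_add_distrib]
    refine sum_le_sum fun a _ => sum_le_sum fun c _ => ?_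
    have hP0 : 0 ≤ ancestorSum N (fun x => f x c) a * ancestorSum N (f a) c :=
      mul_nonneg (ancestorSum_nonneg fun x => hf x c) (ancestorSum_nonneg (hf a))
    set P := ancestorSum N (fun x => f x c) a * ancestorSum N (f a) c
    have hX : 1 ≤ Real.exp (t * biAncestorSum N f a c) :=
      Real.one_le_exp (mul_nonneg ht (biAncestorSum_nonneg hf))
    set X := Real.exp (t * biAncestorSum N f a c)
    rw [htδ]
    have h0 := hf a c
    calc δ ^ 2 * (P * (t * Real.exp (1 / 8) * f a c + t ^ 2 * (P * X)))
        = Real.exp (1 / 8) * (t * δ * P * (δ * f a c)) + (t * δ) ^ 2 * (P ^ 2 * X) := by ring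
      _ = Real.exp (1 / 8) * (1 / 8 * P * (δ * f a c)) + (1 / 8) ^ 2 * (P ^ 2 * X) := by rw [htδ]
      _ ≤ 23 / 20 * (1 / 8 * P * (δ * f a c)) + (1 / 8) ^ 2 * (P ^ 2 * X) := by gcongr
      _ ≤ 23 / 20 * (1 / 8 * P * (δ * f a c)) + (1 / 8) ^ 2 * (P ^ 2 * X) +
          1 / 64 * (P ^ 2 * (X - 1)) := by
          have := mul_nonneg (sq_nonneg P) (sub_nonneg.2 hX)
          linarith
      _ ≤ δ ^ 2 * f a c ^ 2 + 1 / 32 * (P ^ 2 * X) := by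
          nlinarith [sq_nonneg (P / 8 - δ * f a c)]
  rw [htδ] at h hcross
  have h1 : 0 ≤ δ ^ 2 * E + (δ ^ 2 * E + 1 / 32 * Q) := by positivity
  have h2 : Q ≤ 4 * 1.3225 * (δ ^ 2 * E + (δ ^ 2 * E + 1 / 32 * Q)) := by
    refine h.trans ((mul_le_mul_of_nonneg_left (add_le_add_right hcross _)
      (by positivity)).trans ?_)
    exact mul_le_mul_of_nonneg_right (by linarith) h1
  linarith

/-- The function `ψ` whose ancestor sums dominate `exp(τ 𝕀f) - 1`. -/
noncomputable def expMajorant (N : ℕ) (f : List Bool → List Bool → ℝ) (τ : ℝ)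
    (x y : List Bool) : ℝ :=
  (τ * f x y + τ ^ 2 * (ancestorSum N (fun x => f x y) x * ancestorSum N (f x) y)) *
    Real.exp (τ * biAncestorSum N f x y)

theorem sum_expMajorant_sq_le {τ : ℝ} (hδ0 : 0 < δ) (hf : ∀ x y, 0 ≤ f x y)
    (hs1 : ∀ a c, a.length < N → f (a ++ [false]) c + f (a ++ [true]) c ≤ f a c)
    (hs2 : ∀ a c, c.length < N → f a (c ++ [false]) + f a (c ++ [true]) ≤ f a c)
    (hδ : ∀ x y, f x y ≠ 0 → biAncestorSum N f x y ≤ δ) (hτδ : τ * δ = 1 / 16) :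
    ∑ a ∈ strings N, ∑ c ∈ strings N, expMajorant N f τ a c ^ 2 ≤
      4 * τ ^ 2 * ∑ a ∈ strings N, ∑ c ∈ strings N, f a c ^ 2 := by
  have h := sum_sq_mul_exp_le (t := 2 * τ) hδ0 hf hs1 hs2 hδ (by linarith)
  set Q := ∑ a ∈ strings N, ∑ c ∈ strings N,
      (ancestorSum N (fun x => f x c) a * ancestorSum N (f a) c) ^ 2 *
        Real.exp (2 * τ * biAncestorSum N f a c) with hQ
  set E := ∑ a ∈ strings N, ∑ c ∈ strings N, f a c ^ 2 with hE
  have hE0 : 0 ≤ E := sum_nonneg fun a _ => sum_nonneg fun c _ => sq_nonneg _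
  have hτ : 0 ≤ τ := by
    by_contra! h
    nlinarith
  have h1 : ∑ a ∈ strings N, ∑ c ∈ strings N, expMajorant N f τ a c ^ 2 ≤
      2 * τ ^ 2 * (23 / 20) * E + 2 * τ ^ 4 * Q := by
    simp only [hQ, hE, mul_sum, ← sum_add_distrib]
    refine sum_le_sum fun a _ => sum_le_sum fun c _ => ?_
    have hX : Real.exp (2 * τ * biAncestorSum N f a c) =
        Real.exp (τ * biAncestorSum N f a c) ^ 2 := by
      rw [← Real.exp_nat_mul]
      congr 1
      push_cast
      ring
    have hfX : f a c ^ 2 * Real.exp (2 * τ * biAncestorSum N f a c) ≤ 23 / 20 * f a c ^ 2 := by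
      rcases eq_or_ne (f a c) 0 with h0 | h0
      · simp [h0]
      · rw [mul_comm]
        refine mul_le_mul_of_nonneg_right (le_trans (Real.exp_le_exp.2 ?_) exp_one_eighth_le)
          (sq_nonneg _)
        have := mul_le_mul_of_nonneg_left (hδ a c h0) hτ
        linarith
    set P := ancestorSum N (fun x => f x c) a * ancestorSum N (f a) c with hP
    set X := Real.exp (τ * biAncestorSum N f a c)
    rw [hX] at hfX ⊢
    calc expMajorant N f τ a c ^ 2 = (τ * f a c + τ ^ 2 * P) ^ 2 * X ^ 2 := by
          rw [← mul_pow]; rfl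
      _ ≤ (2 * (τ * f a c) ^ 2 + 2 * (τ ^ 2 * P) ^ 2) * X ^ 2 :=
          mul_le_mul_of_nonneg_right (by nlinarith [sq_nonneg (τ * f a c - τ ^ 2 * P)])
            (sq_nonneg _)
      _ = 2 * τ ^ 2 * (f a c ^ 2 * X ^ 2) + 2 * τ ^ 4 * (P ^ 2 * X ^ 2) := by ring
      _ ≤ 2 * τ ^ 2 * (23 / 20 * f a c ^ 2) + 2 * τ ^ 4 * (P ^ 2 * X ^ 2) := by gcongr
      _ = _ := by ring
  have h2 : 2 * τ ^ 4 * Q ≤ 2 * τ ^ 4 * (13 * δ ^ 2 * E) :=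
    mul_le_mul_of_nonneg_left h (by positivity)
  have h3 : 2 * τ ^ 4 * (13 * δ ^ 2 * E) = 26 / 256 * (τ ^ 2 * E) := by
    calc _ = 26 * (τ * δ) ^ 2 * (τ ^ 2 * E) := by ring
      _ = _ := by rw [hτδ]; norm_num
  have h4 : 0 ≤ τ ^ 2 * E := by positivity
  linarith

end Energy

section Measure

variable {N : ℕ} {ν : List Bool × List Bool → ℝ} {ε : ℝ}

theorem sum_biVertices (g : List Bool × List Bool → ℝ) :
    ∑ p ∈ biVertices N, g p = ∑ a ∈ strings N, ∑ c ∈ strings N, g (a, c) :=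
  sum_product _ _ _

theorem biI_eq_biAncestorSum (g : List Bool × List Bool → ℝ) (p : List Bool × List Bool) :
    biI N g p = biAncestorSum N (fun x y => g (x, y)) p.1 p.2 := by
  rw [biI, biVertices, filter_product (fun u => u <+: p.1) (fun u => u <+: p.2), sum_product]
  rfl

theorem biIstar_eq_sum (g : List Bool × List Bool → ℝ) (a c : List Bool) :
    biIstar N g (a, c) = ∑ x ∈ strings N, ∑ y ∈ strings N,
      prefixInd a x * prefixInd c y * g (x, y) := by
  rw [biIstar, biVertices, filter_product (fun u => a <+: u) (fun u => c <+: u), sum_product]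
  simp only [prefixInd, sum_filter]
  refine sum_congr rfl fun x _ => ?_
  split_ifs <;> simp

theorem biIstar_nonneg (hν : ∀ p, 0 ≤ ν p) (p : List Bool × List Bool) : 0 ≤ biIstar N ν p :=
  sum_nonneg fun q _ => hν q

/-- `𝕀` and `𝕀*` are adjoint. -/
theorem sum_mul_biIstar (ψ : List Bool → List Bool → ℝ) :
    ∑ a ∈ strings N, ∑ c ∈ strings N, ψ a c * biIstar N ν (a, c) =
      ∑ x ∈ strings N, ∑ y ∈ strings N, ν (x, y) * biAncestorSum N ψ x y := by
  simp only [biIstar_eq_sum, biAncestorSum_eq_sum, mul_sum]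
  rw [sum_comm_pair]
  refine sum_congr rfl fun x _ => sum_congr rfl fun y _ => sum_congr rfl fun a _ =>
    sum_congr rfl fun c _ => ?_
  ring

theorem prefixInd_append_add_le (a u : List Bool) :
    prefixInd (a ++ [false]) u + prefixInd (a ++ [true]) u ≤ prefixInd a u := by
  unfold prefixInd
  by_cases h1 : a ++ [false] <+: u
  · have h2 : ¬ a ++ [true] <+: u := fun h2 => by
      have := List.prefix_of_prefix_length_le h1 h2 (by simp)
      simp at this
    simp [h1, h2, (List.prefix_append _ _).trans h1]
  · by_cases h2 : a ++ [true] <+: u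
    · simp [h1, h2, (List.prefix_append _ _).trans h2]
    · simp only [h1, h2, if_false]
      split_ifs <;> norm_num

theorem biIstar_append_left_add_le (hν : ∀ p, 0 ≤ ν p) (a c : List Bool) :
    biIstar N ν (a ++ [false], c) + biIstar N ν (a ++ [true], c) ≤ biIstar N ν (a, c) := by
  simp only [biIstar_eq_sum, ← sum_add_distrib]
  refine sum_le_sum fun x _ => sum_le_sum fun y _ => ?_
  have := mul_le_mul_of_nonneg_right (prefixInd_append_add_le a x)
    (mul_nonneg (prefixInd_nonneg c y) (hν (x, y)))
  linarith

theorem biIstar_append_right_add_le (hν : ∀ p, 0 ≤ ν p) (a c : List Bool) :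
    biIstar N ν (a, c ++ [false]) + biIstar N ν (a, c ++ [true]) ≤ biIstar N ν (a, c) := by
  simp only [biIstar_eq_sum, ← sum_add_distrib]
  refine sum_le_sum fun x _ => sum_le_sum fun y _ => ?_
  have := mul_le_mul_of_nonneg_right (prefixInd_append_add_le c y)
    (mul_nonneg (prefixInd_nonneg a x) (hν (x, y)))
  linarith

theorem biV_mono (hν : ∀ p, 0 ≤ ν p) {a a' c c' : List Bool} (ha : a <+: a') (hc : c <+: c') :
    biV N ν (a, c) ≤ biV N ν (a', c') := by
  refine sum_le_sum_of_subset_of_nonneg ?_ fun q _ _ => biIstar_nonneg hν q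
  intro q hq
  simp only [mem_filter] at hq ⊢
  exact ⟨hq.1, hq.2.1.trans ha, hq.2.2.trans hc⟩

/-- The truncation of `𝕀*ν` to the set where the potential is at most `ε`. -/
noncomputable def truncIstar (N : ℕ) (ν : List Bool × List Bool → ℝ) (ε : ℝ)
    (a c : List Bool) : ℝ :=
  if biV N ν (a, c) ≤ ε then biIstar N ν (a, c) else 0

theorem truncIstar_nonneg (hν : ∀ p, 0 ≤ ν p) (a c : List Bool) : 0 ≤ truncIstar N ν ε a c := by
  unfold truncIstar
  split_ifs
  exacts [biIstar_nonneg hν _, le_rfl]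

theorem truncIstar_le (hν : ∀ p, 0 ≤ ν p) (a c : List Bool) :
    truncIstar N ν ε a c ≤ biIstar N ν (a, c) := by
  unfold truncIstar
  split_ifs
  exacts [le_rfl, biIstar_nonneg hν _]

theorem truncIstar_append_left_add_le (hν : ∀ p, 0 ≤ ν p) (a c : List Bool) :
    truncIstar N ν ε (a ++ [false]) c + truncIstar N ν ε (a ++ [true]) c ≤
      truncIstar N ν ε a c := by
  by_cases h : biV N ν (a, c) ≤ ε
  · rw [show truncIstar N ν ε a c = biIstar N ν (a, c) from if_pos h]
    exact (add_le_add (truncIstar_le hν _ _) (truncIstar_le hν _ _)).trans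
      (biIstar_append_left_add_le hν a c)
  · have h' : ∀ x, ¬ biV N ν (a ++ [x], c) ≤ ε := fun x hx =>
      h ((biV_mono hν (List.prefix_append _ _) (List.prefix_refl _)).trans hx)
    simp [truncIstar, h, h']

theorem truncIstar_append_right_add_le (hν : ∀ p, 0 ≤ ν p) (a c : List Bool) :
    truncIstar N ν ε a (c ++ [false]) + truncIstar N ν ε a (c ++ [true]) ≤
      truncIstar N ν ε a c := by
  by_cases h : biV N ν (a, c) ≤ ε
  · rw [show truncIstar N ν ε a c = biIstar N ν (a, c) from if_pos h]
    exact (add_le_add (truncIstar_le hν _ _) (truncIstar_le hν _ _)).trans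
      (biIstar_append_right_add_le hν a c)
  · have h' : ∀ x, ¬ biV N ν (a, c ++ [x]) ≤ ε := fun x hx =>
      h ((biV_mono hν (List.prefix_refl _) (List.prefix_append _ _)).trans hx)
    simp [truncIstar, h, h']

theorem biAncestorSum_truncIstar_le (hν : ∀ p, 0 ≤ ν p) (a c : List Bool)
    (h : truncIstar N ν ε a c ≠ 0) : biAncestorSum N (truncIstar N ν ε) a c ≤ ε := by
  have h1 : biV N ν (a, c) ≤ ε := by
    by_contra h'
    exact h (if_neg h')
  refine le_trans ?_ h1
  rw [biV, biI_eq_biAncestorSum]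
  exact ancestorSum_mono fun x => ancestorSum_mono fun y => truncIstar_le hν x y

theorem biPartialEnergy_eq_sum : biPartialEnergy N ν ε =
    ∑ a ∈ strings N, ∑ c ∈ strings N, truncIstar N ν ε a c ^ 2 := by
  rw [biPartialEnergy, sum_filter, sum_biVertices]
  refine sum_congr rfl fun a _ => sum_congr rfl fun c _ => ?_
  unfold truncIstar
  split_ifs <;> simp

theorem biPartialEnergy_le_biEnergy : biPartialEnergy N ν ε ≤ biEnergy N ν :=
  sum_le_sum_of_subset_of_nonneg (filter_subset _ _) fun _ _ _ => sq_nonneg _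

theorem biPartialEnergy_eq_sum_mul : biPartialEnergy N ν ε =
    ∑ x ∈ strings N, ∑ y ∈ strings N,
      ν (x, y) * biAncestorSum N (truncIstar N ν ε) x y := by
  rw [← sum_mul_biIstar, biPartialEnergy_eq_sum]
  refine sum_congr rfl fun a _ => sum_congr rfl fun c _ => ?_
  unfold truncIstar
  split_ifs <;> ring

/-- A bound for the partial energy with a logarithmic loss only. -/
theorem biPartialEnergy_le_log (hν : ∀ p, 0 ≤ ν p) (hε : 0 < ε) (hε1 : ε < 1) :
    biPartialEnergy N ν ε ≤
      16 * ε * Real.log (1 / ε) * biMass N ν + 2 * ε * biEnergy N ν := by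
  set L := Real.log (1 / ε) with hL
  set f := truncIstar N ν ε
  set τ := 1 / (16 * ε) with hτ
  have hτ0 : 0 < τ := by positivity
  have hτε : τ * ε = 1 / 16 := by rw [hτ]; field_simp
  have hf0 : ∀ x y, 0 ≤ f x y := truncIstar_nonneg hν
  have hpt : ∀ s : ℝ, s ≤ 16 * ε * L + 16 * ε ^ 2 * (Real.exp (τ * s) - 1) := by
    intro s
    have h1 := Real.add_one_le_exp (τ * s - L)
    have h2 : Real.exp (τ * s - L) = Real.exp (τ * s) * ε := by
      rw [sub_eq_add_neg, Real.exp_add, hL, one_div, Real.log_inv, neg_neg, Real.exp_log hε]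
    rw [h2] at h1
    have h3 := mul_le_mul_of_nonneg_left h1 (show 0 ≤ 16 * ε by linarith)
    have h4 : 16 * ε * (τ * s - L + 1) = 16 * (τ * ε) * s - 16 * ε * L + 16 * ε := by ring
    rw [h4, hτε] at h3
    nlinarith
  have hψ := sum_expMajorant_sq_le (N := N) (f := f) (τ := τ) hε hf0
    (fun a c _ => truncIstar_append_left_add_le hν a c)
    (fun a c _ => truncIstar_append_right_add_le hν a c)
    (biAncestorSum_truncIstar_le hν) hτε
  rw [← biPartialEnergy_eq_sum] at hψ
  have hdual : ∑ a ∈ strings N, ∑ c ∈ strings N, expMajorant N f τ a c * biIstar N ν (a, c) ≤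
      2 * τ * biEnergy N ν := by
    have h1 : ∑ a ∈ strings N, ∑ c ∈ strings N, expMajorant N f τ a c * biIstar N ν (a, c) ≤
        1 / (4 * τ) * ∑ a ∈ strings N, ∑ c ∈ strings N, expMajorant N f τ a c ^ 2 +
          τ * biEnergy N ν := by
      rw [biEnergy, sum_biVertices]
      simp only [mul_sum, ← sum_add_distrib]
      refine sum_le_sum fun a _ => sum_le_sum fun c _ => ?_
      rw [← sub_nonneg]
      have : 1 / (4 * τ) * expMajorant N f τ a c ^ 2 + τ * biIstar N ν (a, c) ^ 2 -
          expMajorant N f τ a c * biIstar N ν (a, c) =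
          1 / (4 * τ) * (expMajorant N f τ a c - 2 * τ * biIstar N ν (a, c)) ^ 2 := by
        field_simp
        ring
      rw [this]
      positivity
    have h2 := mul_le_mul_of_nonneg_left hψ (show 0 ≤ 1 / (4 * τ) by positivity)
    have h3 : 1 / (4 * τ) * (4 * τ ^ 2 * biPartialEnergy N ν ε) = τ * biPartialEnergy N ν ε := by
      field_simp
    have h4 := mul_le_mul_of_nonneg_left (biPartialEnergy_le_biEnergy (N := N) (ν := ν) (ε := ε))
      hτ0.le
    linarith
  rw [sum_mul_biIstar] at hdual
  calc biPartialEnergy N ν ε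
      = ∑ x ∈ strings N, ∑ y ∈ strings N, ν (x, y) * biAncestorSum N f x y :=
        biPartialEnergy_eq_sum_mul
    _ ≤ ∑ x ∈ strings N, ∑ y ∈ strings N, (16 * ε * L * ν (x, y) +
        16 * ε ^ 2 * (ν (x, y) * biAncestorSum N (expMajorant N f τ) x y)) := by
        refine sum_le_sum fun x hx => sum_le_sum fun y hy => ?_
        have h1 := exp_biAncestorSum_sub_one_le (N := N) hτ0.le hf0 (mem_strings.1 hx)
          (mem_strings.1 hy)
        have h2 := (hpt (biAncestorSum N f x y)).trans
          (add_le_add_right (mul_le_mul_of_nonneg_left h1 (by positivity)) _)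
        refine (mul_le_mul_of_nonneg_left h2 (hν (x, y))).trans_eq ?_
        unfold expMajorant
        ring
    _ = 16 * ε * L * biMass N ν + 16 * ε ^ 2 *
        ∑ x ∈ strings N, ∑ y ∈ strings N,
          ν (x, y) * biAncestorSum N (expMajorant N f τ) x y := by
        rw [biMass, sum_biVertices]
        simp only [sum_add_distrib, mul_sum]
    _ ≤ 16 * ε * L * biMass N ν + 16 * ε ^ 2 * (2 * τ * biEnergy N ν) := by gcongr
    _ = 16 * ε * L * biMass N ν + 32 * (τ * ε) * ε * biEnergy N ν := by ring
    _ = _ := by rw [hτε]; ring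

end Measure

/-- Consequence of the surrogate maximum principle: if `|ν| ≤ E[ν]` then
`E_ε[ν] ≤ C ε e^{c √(log(1/ε))} E[ν]` for `0 < ε < 1`. -/
theorem stmt8 : ∃ C c : ℝ, 0 < C ∧ 0 < c ∧ ∀ N : ℕ, 1 ≤ N →
    ∀ ν : List Bool × List Bool → ℝ, IsBiMeasureOnBoundary N ν → 0 < biMass N ν →
    biMass N ν ≤ biEnergy N ν →
    ∀ ε : ℝ, 0 < ε → ε < 1 →
    biPartialEnergy N ν ε ≤
      C * ε * Real.exp (c * Real.sqrt (Real.log (1 / ε))) * biEnergy N ν := by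
  refine ⟨32, 1, by norm_num, one_pos, fun N _ ν hν _ hmass ε hε hε1 => ?_⟩
  have h := biPartialEnergy_le_log (N := N) hν.1 hε hε1
  have hL : 0 ≤ Real.log (1 / ε) := Real.log_nonneg (by rw [le_div_iff₀ hε]; linarith)
  have hE : 0 ≤ biEnergy N ν := sum_nonneg fun _ _ => sq_nonneg _
  have hquad := Real.quadratic_le_exp_of_nonneg (Real.sqrt_nonneg (Real.log (1 / ε)))
  rw [Real.sq_sqrt hL] at hquad
  have hs := Real.sqrt_nonneg (Real.log (1 / ε))
  rw [one_mul]
  calc _ ≤ 16 * ε * Real.log (1 / ε) * biEnergy N ν + 2 * ε * biEnergy N ν :=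
        h.trans (add_le_add (mul_le_mul_of_nonneg_left hmass (by positivity)) le_rfl)
    _ = ε * biEnergy N ν * (16 * Real.log (1 / ε) + 2) := by ring
    _ ≤ ε * biEnergy N ν * (32 * Real.exp (Real.sqrt (Real.log (1 / ε)))) :=
        mul_le_mul_of_nonneg_left (by linarith) (by positivity)
    _ = _ := by ring
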